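/- arXiv:1805.07732 — 5 statements merged into one kernel-verified Lean document; each statement's English description precedes it below -/
import Mathlib

section
/- Adding an independent random variable does not increase the Cramér distance: for all Borel probability measures P, Q, ν on ℝ, ℓ₂(P ∗ ν, Q ∗ ν) ≤ ℓ₂(P,Q), where ∗ denotes the convolution of measures (i.e., the law of the sum of independent random variables with laws P (resp. Q) and ν). -/
open MeasureTheory

/-- Cumulative distribution function of a Borel measure on ℝ. -/
noncomputable def cdf (P : Measure ℝ) (x : ℝ) : ℝ := (P (Set.Iic x)).toReal

/-- Squared Cramér distance, valued in `[0,∞]`. -/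
noncomputable def cramerSq (P Q : Measure ℝ) : ENNReal :=
  ∫⁻ x, ENNReal.ofReal ((cdf P x - cdf Q x) ^ 2)

/-- Cramér distance, valued in `[0,∞]`. -/
noncomputable def cramer (P Q : Measure ℝ) : ENNReal :=
  cramerSq P Q ^ (1 / 2 : ℝ)

/-- Convolution of two Borel measures on ℝ: the pushforward of the product
measure under addition. -/
noncomputable def mconv (P ν : Measure ℝ) : Measure ℝ :=
  (P.prod ν).map (fun p : ℝ × ℝ => p.1 + p.2)

lemma monotone_cdf (P : Measure ℝ) [IsFiniteMeasure P] : Monotone (cdf P) := fun _ _ h =>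
  measureReal_mono (Set.Iic_subset_Iic.2 h)

lemma measurable_cdf (P : Measure ℝ) [IsFiniteMeasure P] : Measurable (cdf P) :=
  (monotone_cdf P).measurable

lemma cdf_nonneg (P : Measure ℝ) (x : ℝ) : 0 ≤ cdf P x := ENNReal.toReal_nonneg

lemma cdf_le_one (P : Measure ℝ) [IsProbabilityMeasure P] (x : ℝ) : cdf P x ≤ 1 :=
  measureReal_le_one

lemma integrable_cdf_sub (P ν : Measure ℝ) [IsProbabilityMeasure P] [IsFiniteMeasure ν] (x : ℝ) :
    Integrable (fun y => cdf P (x - y)) ν := by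
  refine Integrable.of_bound
    ((measurable_cdf P).comp (measurable_const.sub measurable_id)).aestronglyMeasurable 1
    (ae_of_all _ fun y => ?_)
  rw [Real.norm_of_nonneg (cdf_nonneg P _)]
  exact cdf_le_one P _

/-- The distribution function of a convolution is the average of the translated ones. -/
lemma cdf_mconv (P ν : Measure ℝ) [IsFiniteMeasure P] [IsFiniteMeasure ν] (x : ℝ) :
    cdf (mconv P ν) x = ∫ y, cdf P (x - y) ∂ν := by
  have hadd : Measurable fun p : ℝ × ℝ => p.1 + p.2 := by fun_prop
  have hslice (y : ℝ) :
      (fun z => (z, y)) ⁻¹' ((fun p : ℝ × ℝ => p.1 + p.2) ⁻¹' Set.Iic x) = Set.Iic (x - y) := by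
    ext z
    simp [le_sub_iff_add_le]
  have hmeas : Measurable fun y => P (Set.Iic (x - y)) := by
    simpa only [hslice] using
      measurable_measure_prodMk_right (μ := P) (hadd (measurableSet_Iic (a := x)))
  unfold cdf mconv
  rw [Measure.map_apply hadd measurableSet_Iic,
    Measure.prod_apply_symm (hadd measurableSet_Iic),
    integral_toReal hmeas.aemeasurable (ae_of_all _ fun y => measure_lt_top _ _)]
  simp only [hslice]

/-- The Jensen inequality for the square of a bounded difference of distribution functions. -/
lemma ofReal_sq_cdf_mconv_sub_le (P Q ν : Measure ℝ)
    [IsProbabilityMeasure P] [IsProbabilityMeasure Q] [IsProbabilityMeasure ν] (x : ℝ) :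
    ENNReal.ofReal ((cdf (mconv P ν) x - cdf (mconv Q ν) x) ^ 2) ≤
      ∫⁻ y, ENNReal.ofReal ((cdf P (x - y) - cdf Q (x - y)) ^ 2) ∂ν := by
  have hint : Integrable (fun y => cdf P (x - y) - cdf Q (x - y)) ν :=
    (integrable_cdf_sub P ν x).sub (integrable_cdf_sub Q ν x)
  have hsq : Integrable (fun y => (cdf P (x - y) - cdf Q (x - y)) ^ 2) ν := by
    refine Integrable.of_bound (hint.aestronglyMeasurable.pow 2) 1 (ae_of_all _ fun y => ?_)
    rw [Real.norm_of_nonneg (sq_nonneg _), sq_le_one_iff_abs_le_one, abs_le]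
    constructor <;>
      linarith [cdf_nonneg P (x - y), cdf_le_one P (x - y), cdf_nonneg Q (x - y),
        cdf_le_one Q (x - y)]
  rw [cdf_mconv, cdf_mconv, ← integral_sub (integrable_cdf_sub P ν x) (integrable_cdf_sub Q ν x),
    ← ofReal_integral_eq_lintegral_ofReal hsq (ae_of_all _ fun y => sq_nonneg _)]
  exact ENNReal.ofReal_le_ofReal <| even_two.convexOn_pow.map_integral_le
    (continuous_pow 2).continuousOn isClosed_univ (ae_of_all _ fun y => Set.mem_univ _) hint hsq

lemma cramerSq_mconv_le (P Q ν : Measure ℝ)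
    [IsProbabilityMeasure P] [IsProbabilityMeasure Q] [IsProbabilityMeasure ν] :
    cramerSq (mconv P ν) (mconv Q ν) ≤ cramerSq P Q := by
  have hmeas : Measurable fun x => ENNReal.ofReal ((cdf P x - cdf Q x) ^ 2) :=
    (((measurable_cdf P).sub (measurable_cdf Q)).pow_const 2).ennreal_ofReal
  calc cramerSq (mconv P ν) (mconv Q ν)
      ≤ ∫⁻ x, ∫⁻ y, ENNReal.ofReal ((cdf P (x - y) - cdf Q (x - y)) ^ 2) ∂ν :=
        lintegral_mono fun x => ofReal_sq_cdf_mconv_sub_le P Q ν x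
    _ = ∫⁻ y, ∫⁻ x, ENNReal.ofReal ((cdf P (x - y) - cdf Q (x - y)) ^ 2) ∂volume ∂ν :=
        lintegral_lintegral_swap (hmeas.comp (measurable_fst.sub measurable_snd)).aemeasurable
    _ = ∫⁻ _, cramerSq P Q ∂ν := lintegral_congr fun y =>
        lintegral_sub_right_eq_self (fun x => ENNReal.ofReal ((cdf P x - cdf Q x) ^ 2)) y
    _ = cramerSq P Q := by simp

/-- Adding an independent random variable does not increase the Cramér distance. -/
theorem cramer_conv_le (P Q ν : Measure ℝ)
    [IsProbabilityMeasure P] [IsProbabilityMeasure Q] [IsProbabilityMeasure ν] :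
    cramer (mconv P ν) (mconv Q ν) ≤ cramer P Q := by
  exact ENNReal.rpow_le_rpow (cramerSq_mconv_le P Q ν) (by norm_num)
end

section
/- Under the affine map x ↦ r + γx with γ > 0 and r ∈ ℝ, the squared Cramér distance contracts exactly by the factor γ: for all Borel probability measures P, Q on ℝ, ℓ₂²((x ↦ r + γx)_*P, (x ↦ r + γx)_*Q) = γ · ℓ₂²(P,Q), where f_*P denotes the pushforward of the measure P under the map f. -/
open MeasureTheory

theorem cdf_map_affine (P : Measure ℝ) (r x : ℝ) {γ : ℝ} (hγ : 0 < γ) :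
    cdf (P.map (fun y => r + γ * y)) (r + γ * x) = cdf P x := by
  have hpre : (fun y => r + γ * y) ⁻¹' Set.Iic (r + γ * x) = Set.Iic x := by
    ext y
    simp [hγ]
  rw [cdf, Measure.map_apply (by fun_prop) measurableSet_Iic, hpre, cdf]

theorem lintegral_eq_mul_lintegral_comp_affine (f : ℝ → ENNReal) (r : ℝ) {γ : ℝ} (hγ : 0 < γ) :
    ∫⁻ x, f x = ENNReal.ofReal γ * ∫⁻ x, f (r + γ * x) := by
  rw [← lintegral_add_left_eq_self f r]
  conv_lhs => rw [← Real.smul_map_volume_mul_left hγ.ne', abs_of_pos hγ]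
  rw [lintegral_smul_measure, (measurableEmbedding_mulLeft₀ hγ.ne').lintegral_map, smul_eq_mul]

/-- Under the affine map x ↦ r + γx with γ > 0, the squared Cramér distance
contracts exactly by the factor γ. -/
theorem cramerSq_affine (P Q : Measure ℝ)
    [IsProbabilityMeasure P] [IsProbabilityMeasure Q] (r γ : ℝ) (hγ : 0 < γ) :
    cramerSq (P.map (fun x => r + γ * x)) (Q.map (fun x => r + γ * x))
      = ENNReal.ofReal γ * cramerSq P Q := by
  rw [cramerSq, lintegral_eq_mul_lintegral_comp_affine _ r hγ]
  simp only [cdf_map_affine _ _ _ hγ, cramerSq]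
end

section
/- Projected Bellman error rewrite (the identity underlying the MSPBE and D-MSPBE formulations): let n, d ∈ ℕ, let Φ be a real n × d matrix, let D be a real n × n diagonal matrix with nonnegative diagonal entries such that ΦᵀDΦ is invertible, and define the projection matrix Π = Φ(ΦᵀDΦ)⁻¹ΦᵀD. Then for every θ ∈ ℝᵈ and every u ∈ ℝⁿ, ‖Φθ − Πu‖²_D = (ΦᵀD(Φθ − u))ᵀ (ΦᵀDΦ)⁻¹ (ΦᵀD(Φθ − u)). -/
open Matrix

/-- Projected Bellman error rewrite underlying the MSPBE and D-MSPBE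
formulations. -/
theorem projected_bellman_error_rewrite (n d : ℕ)
    (Φ : Matrix (Fin n) (Fin d) ℝ) (dv : Fin n → ℝ) (hdv : ∀ i, 0 ≤ dv i)
    (D : Matrix (Fin n) (Fin n) ℝ) (hD : D = Matrix.diagonal dv)
    (hinv : IsUnit (Φᵀ * D * Φ))
    (Pr : Matrix (Fin n) (Fin n) ℝ) (hPr : Pr = Φ * (Φᵀ * D * Φ)⁻¹ * Φᵀ * D)
    (θ : Fin d → ℝ) (u : Fin n → ℝ) :
    ∑ i, dv i * ((Φ.mulVec θ - Pr.mulVec u) i) ^ 2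
      = ((Φᵀ * D).mulVec (Φ.mulVec θ - u)) ⬝ᵥ
          ((Φᵀ * D * Φ)⁻¹.mulVec ((Φᵀ * D).mulVec (Φ.mulVec θ - u))) := by
  have hdet : IsUnit (Φᵀ * D * Φ).det := (Matrix.isUnit_iff_isUnit_det _).mp hinv
  set g := (Φᵀ * D).mulVec (Φ.mulVec θ - u) with hg
  set w := (Φᵀ * D * Φ)⁻¹.mulVec g with hw
  have herr : Φ.mulVec θ - Pr.mulVec u = Φ.mulVec w := by
    rw [hw, hg, Matrix.mulVec_sub, Matrix.mulVec_sub, Matrix.mulVec_sub,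
      Matrix.mulVec_mulVec θ (Φᵀ * D), Matrix.mulVec_mulVec θ (Φᵀ * D * Φ)⁻¹,
      Matrix.nonsing_inv_mul _ hdet, Matrix.one_mulVec, hPr,
      Matrix.mulVec_mulVec, Matrix.mulVec_mulVec]
    simp only [Matrix.mul_assoc]
  have hAw : (Φᵀ * D * Φ).mulVec w = g := by
    rw [hw, Matrix.mulVec_mulVec, Matrix.mul_nonsing_inv _ hdet, Matrix.one_mulVec]
  calc ∑ i, dv i * ((Φ.mulVec θ - Pr.mulVec u) i) ^ 2
      = Φ.mulVec w ⬝ᵥ D.mulVec (Φ.mulVec w) := by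
        rw [herr, hD]
        simp only [dotProduct, Matrix.mulVec_diagonal]
        exact Finset.sum_congr rfl fun i _ => by ring
    _ = w ⬝ᵥ (Φᵀ * D * Φ).mulVec w := by
        rw [← Matrix.mulVec_mulVec, ← Matrix.mulVec_mulVec, Matrix.dotProduct_mulVec w Φᵀ,
          Matrix.vecMul_transpose]
    _ = g ⬝ᵥ w := by rw [hAw, dotProduct_comm]
end

section
/- Gradient of the distributional MSPBE, GTD2 form: under the stated setup, the gradient of J at θ₀ satisfies −½ ∇_θ J(θ₀) = ∑_{s} ρ(s) ∑_{s'} P(s,s') ∑_{j=1}^m ⟨φ_{θ₀}(s,z_j), w⟩ · ( φ_{θ₀}(s,z_j) − φ_{θ₀}(s', (z_j − R(s))/γ) ) − h, where w = A(θ₀)⁻¹ g(θ₀) and h = ∑_{s} ρ(s) ∑_{s'} P(s,s') ∑_{j=1}^m ( δ_{θ₀}(s,s',j) − ⟨w, φ_{θ₀}(s,z_j)⟩ ) · ( ∇²_θ F_{θ₀}(s,z_j) ) w, with ∇²_θ F_{θ₀}(s,z_j) the Hessian matrix of θ ↦ F_θ(s,z_j) at θ₀. -/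
open Matrix

section Calculus

variable {E : Type*} [NormedAddCommGroup E] [NormedSpace ℝ E] {n : Type*} [Fintype n]

theorem DifferentiableAt.matrix_det [DecidableEq n] {M : E → Matrix n n ℝ} {x : E}
    (hM : ∀ i j, DifferentiableAt ℝ (fun y => M y i j) x) :
    DifferentiableAt ℝ (fun y => (M y).det) x := by
  simp only [Matrix.det_apply']
  exact DifferentiableAt.fun_sum fun σ _ =>
    (HasFDerivAt.finsetProd fun i _ => (hM (σ i) i).hasFDerivAt).differentiableAt.const_mul _

theorem DifferentiableAt.matrix_inv_apply [DecidableEq n] {M : E → Matrix n n ℝ} {x : E}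
    (hM : ∀ i j, DifferentiableAt ℝ (fun y => M y i j) x) (hx : IsUnit (M x)) (i j : n) :
    DifferentiableAt ℝ (fun y => (M y)⁻¹ i j) x := by
  simp only [Matrix.inv_def, Ring.inverse_eq_inv', Matrix.smul_apply, smul_eq_mul,
    Matrix.adjugate_apply]
  refine (DifferentiableAt.matrix_det hM).fun_inv ?_ |>.mul (DifferentiableAt.matrix_det ?_)
  · exact ((Matrix.isUnit_iff_isUnit_det _).1 hx).ne_zero
  · intro k l
    by_cases hk : k = j
    · subst hk
      simp
    · simpa [Matrix.updateRow_ne hk] using hM k l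

theorem HasFDerivAt.quadratic_of_eq_zero {M : E → Matrix n n ℝ} {e : E → n → ℝ} {x : E}
    (hM : ∀ i j, DifferentiableAt ℝ (fun y => M y i j) x)
    (he : ∀ i, DifferentiableAt ℝ (fun y => e y i) x) (hx : e x = 0) :
    HasFDerivAt (fun y => e y ⬝ᵥ M y *ᵥ e y) (0 : E →L[ℝ] ℝ) x := by
  have hMe : ∀ i, DifferentiableAt ℝ (fun y => (M y *ᵥ e y) i) x := fun i =>
    DifferentiableAt.fun_sum fun j _ => (hM i j).mul (he j)
  have h := HasFDerivAt.fun_sum (u := Finset.univ) fun i _ =>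
    (he i).hasFDerivAt.mul (hMe i).hasFDerivAt
  simp only [hx, mulVec_zero, Pi.zero_apply, zero_smul, add_zero, Finset.sum_const_zero] at h
  exact h

/-- The derivative of `gᵀ M⁻¹ g` for symmetric `M`, with `w = M⁻¹ g` held fixed. -/
theorem HasFDerivAt.dotProduct_inv_mulVec [DecidableEq n] {M : E → Matrix n n ℝ} {g : E → n → ℝ}
    {x : E} {w : n → ℝ} {G Q : E →L[ℝ] ℝ} (hsymm : ∀ y, (M y).IsSymm)
    (hM : ∀ i j, DifferentiableAt ℝ (fun y => M y i j) x)
    (hg : ∀ i, DifferentiableAt ℝ (fun y => g y i) x)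
    (hinv : ∀ᶠ y in nhds x, IsUnit (M y)) (hw : w = (M x)⁻¹ *ᵥ g x)
    (hG : HasFDerivAt (fun y => w ⬝ᵥ g y) G x)
    (hQ : HasFDerivAt (fun y => w ⬝ᵥ M y *ᵥ w) Q x) :
    HasFDerivAt (fun y => g y ⬝ᵥ (M y)⁻¹ *ᵥ g y) ((2 : ℝ) • G - Q) x := by
  have he : ∀ i, DifferentiableAt ℝ (fun y => ((M y)⁻¹ *ᵥ g y - w) i) x := fun i =>
    (DifferentiableAt.fun_sum fun j _ =>
      (DifferentiableAt.matrix_inv_apply hM hinv.self_of_nhds i j).mul (hg j)).sub_const _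
  have h0 := HasFDerivAt.quadratic_of_eq_zero hM he (by simp [hw])
  have h := ((hG.const_smul (2 : ℝ)).sub hQ).add h0
  rw [add_zero] at h
  refine h.congr_of_eventuallyEq (hinv.mono fun y hy => ?_)
  have hMu : M y *ᵥ (M y)⁻¹ *ᵥ g y = g y := by
    rw [mulVec_mulVec, mul_nonsing_inv _ ((isUnit_iff_isUnit_det _).1 hy), one_mulVec]
  have hswap : ((M y)⁻¹ *ᵥ g y) ⬝ᵥ M y *ᵥ w = w ⬝ᵥ g y := by
    rw [dotProduct_mulVec, ← mulVec_transpose, (hsymm y).eq, hMu, dotProduct_comm]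
  simp only [Pi.add_apply, Pi.sub_apply, Pi.smul_apply, smul_eq_mul, mulVec_sub, dotProduct_sub,
    sub_dotProduct, hMu, hswap]
  rw [dotProduct_comm (g y)]
  ring

theorem ContinuousLinearMap.apply_eq_dotProduct_single [DecidableEq n] (L : (n → ℝ) →L[ℝ] ℝ)
    (v : n → ℝ) :
    L v = (fun i => L (Pi.single i 1)) ⬝ᵥ v := by
  conv_lhs => rw [pi_eq_sum_univ' v]
  simp [dotProduct, mul_comm, Pi.single]

end Calculus

/-- Gradient of the distributional MSPBE, GTD2/TDC setup. -/
theorem dmspbe_gradient_gtd2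
    (d m : ℕ) (S : Type*) [Fintype S] [Nonempty S]
    (ρ : S → ℝ) (hρ0 : ∀ s, 0 ≤ ρ s) (hρ1 : ∑ s, ρ s = 1)
    (P : S → S → ℝ) (hP0 : ∀ s s', 0 ≤ P s s') (hP1 : ∀ s, ∑ s', P s s' = 1)
    (R : S → ℝ) (γ : ℝ) (hγ0 : 0 < γ) (hγ1 : γ < 1)
    (z : Fin m → ℝ)
    (F : (Fin d → ℝ) → S → ℝ → ℝ)
    (hF : ∀ s x, ContDiff ℝ 2 (fun θ => F θ s x))
    (φ : (Fin d → ℝ) → S → ℝ → (Fin d → ℝ))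
    (hφ : ∀ θ s x i, φ θ s x i = fderiv ℝ (fun θ' => F θ' s x) θ (Pi.single i 1))
    (δ : (Fin d → ℝ) → S → S → Fin m → ℝ)
    (hδ : ∀ θ s s' j, δ θ s s' j = F θ s' ((z j - R s) / γ) - F θ s (z j))
    (A : (Fin d → ℝ) → Matrix (Fin d) (Fin d) ℝ)
    (hA : ∀ θ, A θ = ∑ s, ∑ j, ρ s • vecMulVec (φ θ s (z j)) (φ θ s (z j)))
    (g : (Fin d → ℝ) → (Fin d → ℝ))
    (hg : ∀ θ, g θ = ∑ s, ∑ s', ∑ j, (ρ s * P s s' * δ θ s s' j) • φ θ s (z j))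
    (J : (Fin d → ℝ) → ℝ)
    (hJ : ∀ θ, J θ = g θ ⬝ᵥ (A θ)⁻¹.mulVec (g θ))
    (θ₀ : Fin d → ℝ)
    (hAinv : ∀ᶠ θ in nhds θ₀, IsUnit (A θ))
    (w : Fin d → ℝ) (hw : w = (A θ₀)⁻¹.mulVec (g θ₀))
    (Hess : S → Fin m → Matrix (Fin d) (Fin d) ℝ)
    (hHess : ∀ s j i k, Hess s j i k =
      fderiv ℝ (fun θ => fderiv ℝ (fun θ' => F θ' s (z j)) θ (Pi.single k 1)) θ₀
        (Pi.single i 1))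
    (h : Fin d → ℝ)
    (hh : h = ∑ s, ∑ s', ∑ j,
      (ρ s * P s s' * (δ θ₀ s s' j - w ⬝ᵥ φ θ₀ s (z j))) • (Hess s j).mulVec w) :
    ∀ v : Fin d → ℝ,
      -(1 / 2) * fderiv ℝ J θ₀ v =
        ((∑ s, ∑ s', ∑ j,
            (ρ s * P s s' * (φ θ₀ s (z j) ⬝ᵥ w)) •
              (φ θ₀ s (z j) - φ θ₀ s' ((z j - R s) / γ))) - h) ⬝ᵥ v := by
  intro v
  have hF1 : ∀ s x, HasFDerivAt (fun θ => F θ s x) (fderiv ℝ (fun θ => F θ s x) θ₀) θ₀ :=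
    fun s x => ((hF s x).differentiable (by norm_num) θ₀).hasFDerivAt
  have hφd : ∀ s x i, DifferentiableAt ℝ (fun θ => φ θ s x i) θ₀ := by
    intro s x i
    simp only [hφ]
    exact (((hF s x).fderiv_right (m := 1) (by norm_num)).differentiable (by norm_num) θ₀).clm_apply
      (differentiableAt_const _)
  have hFv : ∀ s x, fderiv ℝ (fun θ => F θ s x) θ₀ v = φ θ₀ s x ⬝ᵥ v := by
    intro s x
    rw [ContinuousLinearMap.apply_eq_dotProduct_single]
    congr 1
    ext i
    rw [hφ]
  have hwφ : ∀ s x, HasFDerivAt (fun θ => w ⬝ᵥ φ θ s x)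
      (∑ k, w k • fderiv ℝ (fun θ => φ θ s x k) θ₀) θ₀ := fun s x =>
    HasFDerivAt.fun_sum fun k _ => (hφd s x k).hasFDerivAt.const_mul (w k)
  have hwφv : ∀ s j, (∑ k, w k • fderiv ℝ (fun θ => φ θ s (z j) k) θ₀) v =
      (Hess s j *ᵥ w) ⬝ᵥ v := by
    intro s j
    rw [ContinuousLinearMap.apply_eq_dotProduct_single]
    congr 1
    ext i
    simp [mulVec, dotProduct, hHess, hφ, mul_comm]
  have hδd : ∀ s s' j, HasFDerivAt (fun θ => δ θ s s' j)
      (fderiv ℝ (fun θ => F θ s' ((z j - R s) / γ)) θ₀ - fderiv ℝ (fun θ => F θ s (z j)) θ₀)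
      θ₀ := by
    intro s s' j
    simp only [hδ]
    exact (hF1 _ _).sub (hF1 _ _)
  have hwg : ∀ θ, w ⬝ᵥ g θ =
      ∑ s, ∑ s', ∑ j, ρ s * P s s' * (δ θ s s' j * (w ⬝ᵥ φ θ s (z j))) := by
    intro θ
    simp only [hg, dotProduct_sum, dotProduct_smul, smul_eq_mul, mul_assoc]
  have hwA : ∀ θ, w ⬝ᵥ A θ *ᵥ w =
      ∑ s, ∑ s', ∑ j, ρ s * P s s' * ((w ⬝ᵥ φ θ s (z j)) * (w ⬝ᵥ φ θ s (z j))) := by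
    intro θ
    simp only [hA, sum_mulVec, dotProduct_sum, smul_mulVec, dotProduct_smul, smul_eq_mul,
      vecMulVec_mulVec]
    refine Finset.sum_congr rfl fun s _ => ?_
    rw [Finset.sum_comm]
    refine Finset.sum_congr rfl fun j _ => ?_
    rw [← Finset.sum_mul, ← Finset.mul_sum, hP1, mul_one]
    simp [dotProduct_comm]
  have hG := HasFDerivAt.fun_sum (u := Finset.univ) fun s _ =>
    HasFDerivAt.fun_sum (u := Finset.univ) fun s' _ =>
    HasFDerivAt.fun_sum (u := Finset.univ) fun j _ =>
    ((hδd s s' j).mul (hwφ s (z j))).const_mul (ρ s * P s s')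
  have hQ := HasFDerivAt.fun_sum (u := Finset.univ) fun s _ =>
    HasFDerivAt.fun_sum (u := Finset.univ) fun s' _ =>
    HasFDerivAt.fun_sum (u := Finset.univ) fun j _ =>
    ((hwφ s (z j)).mul (hwφ s (z j))).const_mul (ρ s * P s s')
  have hsymm : ∀ θ, (A θ).IsSymm := by
    intro θ
    ext i k
    simp [hA, Matrix.sum_apply, vecMulVec_apply, mul_comm]
  have hAd : ∀ i k, DifferentiableAt ℝ (fun θ => A θ i k) θ₀ := by
    intro i k
    simp only [hA, Matrix.sum_apply, Matrix.smul_apply, vecMulVec_apply, smul_eq_mul]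
    exact DifferentiableAt.fun_sum fun s _ => DifferentiableAt.fun_sum fun j _ =>
      ((hφd _ _ _).mul (hφd _ _ _)).const_mul _
  have hgd : ∀ i, DifferentiableAt ℝ (fun θ => g θ i) θ₀ := by
    intro i
    simp only [hg, Finset.sum_apply, Pi.smul_apply, smul_eq_mul]
    exact DifferentiableAt.fun_sum fun s _ => DifferentiableAt.fun_sum fun s' _ =>
      DifferentiableAt.fun_sum fun j _ =>
      ((hδd _ _ _).differentiableAt.const_mul _).mul (hφd _ _ _)
  have hJd := HasFDerivAt.dotProduct_inv_mulVec hsymm hAd hgd hAinv hw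
    (hG.congr_of_eventuallyEq (.of_forall hwg)) (hQ.congr_of_eventuallyEq (.of_forall hwA))
  rw [show J = fun θ => g θ ⬝ᵥ (A θ)⁻¹ *ᵥ g θ from funext hJ, hJd.fderiv, hh]
  simp only [_root_.sub_apply, _root_.smul_apply,
    _root_.add_apply, _root_.sum_apply, hwφv, hFv, smul_eq_mul,
    sub_dotProduct, sum_dotProduct, smul_dotProduct]
  simp only [Finset.mul_sum, ← Finset.sum_sub_distrib]
  refine Finset.sum_congr rfl fun s _ => Finset.sum_congr rfl fun s' _ =>
    Finset.sum_congr rfl fun j _ => ?_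
  rw [dotProduct_comm (φ θ₀ s (z j)) w]
  ring
end

section
/- Gradient of the distributional MSPBE, TDC form: under the stated setup, the gradient of J at θ₀ satisfies −½ ∇_θ J(θ₀) = − ∑_{s} ρ(s) ∑_{s'} P(s,s') ∑_{j=1}^m ⟨φ_{θ₀}(s,z_j), w⟩ · φ_{θ₀}(s', (z_j − R(s))/γ) + ∑_{s} ρ(s) ∑_{s'} P(s,s') ∑_{j=1}^m δ_{θ₀}(s,s',j) · φ_{θ₀}(s,z_j) − h, where w = A(θ₀)⁻¹ g(θ₀) and h = ∑_{s} ρ(s) ∑_{s'} P(s,s') ∑_{j=1}^m ( δ_{θ₀}(s,s',j) − ⟨w, φ_{θ₀}(s,z_j)⟩ ) · ( ∇²_θ F_{θ₀}(s,z_j) ) w, with ∇²_θ F_{θ₀}(s,z_j) the Hessian matrix of θ ↦ F_θ(s,z_j) at θ₀. -/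
open Matrix

theorem Matrix.differentiableAt_det {n E : Type*} [Fintype n] [DecidableEq n]
    [NormedAddCommGroup E] [NormedSpace ℝ E] {A : E → Matrix n n ℝ} {x : E}
    (hA : ∀ i j, DifferentiableAt ℝ (fun y => A y i j) x) :
    DifferentiableAt ℝ (fun y => (A y).det) x := by
  simp only [Matrix.det_apply']
  exact DifferentiableAt.fun_sum fun σ _ =>
    (HasFDerivAt.finsetProd fun i _ =>
      (hA (σ i) i).hasFDerivAt).differentiableAt.const_mul _

theorem Matrix.differentiableAt_inv_apply {n E : Type*} [Fintype n] [DecidableEq n]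
    [NormedAddCommGroup E] [NormedSpace ℝ E] {A : E → Matrix n n ℝ} {x : E}
    (hA : ∀ i j, DifferentiableAt ℝ (fun y => A y i j) x) (hx : IsUnit (A x)) (i j : n) :
    DifferentiableAt ℝ (fun y => (A y)⁻¹ i j) x := by
  have hdet : (A x).det ≠ 0 := ((Matrix.isUnit_iff_isUnit_det _).1 hx).ne_zero
  simp only [Matrix.inv_def, Matrix.smul_apply, smul_eq_mul, Ring.inverse_eq_inv',
    Matrix.adjugate_apply]
  refine ((Matrix.differentiableAt_det hA).fun_inv hdet).fun_mul
    (Matrix.differentiableAt_det fun k l => ?_)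
  by_cases hk : k = j
  · subst hk
    simp
  · simpa [Matrix.updateRow_ne hk] using hA k l

/-- Completing the square for the quadratic form of an inverse symmetric matrix. -/
theorem Matrix.dotProduct_inv_mulVec_eq {n : Type*} [Fintype n] [DecidableEq n]
    {M : Matrix n n ℝ} (hM : M.IsSymm) (hu : IsUnit M) (b w : n → ℝ) :
    b ⬝ᵥ M⁻¹ *ᵥ b =
      2 * (b ⬝ᵥ w) - w ⬝ᵥ M *ᵥ w + (b - M *ᵥ w) ⬝ᵥ M⁻¹ *ᵥ (b - M *ᵥ w) := by
  have hdet := (Matrix.isUnit_iff_isUnit_det _).1 hu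
  have hinv : M⁻¹ *ᵥ (M *ᵥ w) = w := by
    rw [Matrix.mulVec_mulVec, Matrix.nonsing_inv_mul _ hdet, Matrix.one_mulVec]
  have hcross : (M *ᵥ w) ⬝ᵥ M⁻¹ *ᵥ b = b ⬝ᵥ w := by
    rw [Matrix.dotProduct_mulVec, ← Matrix.mulVec_transpose, Matrix.transpose_nonsing_inv,
      hM.eq, hinv, dotProduct_comm]
  rw [Matrix.mulVec_sub, hinv, sub_dotProduct, dotProduct_sub, dotProduct_sub, hcross,
    dotProduct_comm (M *ᵥ w) w]
  ring

/-- Envelope formula: the weight vector `(A x)⁻¹ *ᵥ g x` may be held fixed when differentiating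
`g ⬝ᵥ A⁻¹ *ᵥ g` at `x`. -/
theorem Matrix.hasFDerivAt_dotProduct_inv_mulVec {n E : Type*} [Fintype n] [DecidableEq n]
    [NormedAddCommGroup E] [NormedSpace ℝ E] {A : E → Matrix n n ℝ} {g : E → n → ℝ} {x : E}
    (hsymm : ∀ y, (A y).IsSymm)
    (hA : ∀ i j, DifferentiableAt ℝ (fun y => A y i j) x)
    (hg : ∀ i, DifferentiableAt ℝ (fun y => g y i) x)
    (hu : ∀ᶠ y in nhds x, IsUnit (A y)) {w : n → ℝ} (hw : w = (A x)⁻¹ *ᵥ g x)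
    {G Q : E →L[ℝ] ℝ} (hG : HasFDerivAt (fun y => g y ⬝ᵥ w) G x)
    (hQ : HasFDerivAt (fun y => w ⬝ᵥ A y *ᵥ w) Q x) :
    HasFDerivAt (fun y => g y ⬝ᵥ (A y)⁻¹ *ᵥ g y) ((2 : ℝ) • G - Q) x := by
  have hux : IsUnit (A x) := hu.self_of_nhds
  have hr0 : ∀ i, (g x - A x *ᵥ w) i = 0 := fun i => by
    rw [hw, Matrix.mulVec_mulVec,
      Matrix.mul_nonsing_inv _ ((Matrix.isUnit_iff_isUnit_det _).1 hux), Matrix.one_mulVec,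
      sub_self, Pi.zero_apply]
  have hr : ∀ i, DifferentiableAt ℝ (fun y => (g y - A y *ᵥ w) i) x := fun i => by
    simp only [Pi.sub_apply, Matrix.mulVec, dotProduct]
    exact (hg i).fun_sub (DifferentiableAt.fun_sum fun k _ => (hA i k).mul_const _)
  have hrem : HasFDerivAt
      (fun y => (g y - A y *ᵥ w) ⬝ᵥ (A y)⁻¹ *ᵥ (g y - A y *ᵥ w)) (0 : E →L[ℝ] ℝ) x := by
    have hterm : ∀ i k, HasFDerivAt
        (fun y => (g y - A y *ᵥ w) i * ((A y)⁻¹ i k * (g y - A y *ᵥ w) k))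
        (0 : E →L[ℝ] ℝ) x := fun i k => by
      have hi := (hr i).hasFDerivAt
      have hk := ((Matrix.differentiableAt_inv_apply hA hux i k).fun_mul (hr k)).hasFDerivAt
      refine (hi.fun_mul hk).congr_fderiv ?_
      rw [hr0 i, hr0 k]
      simp
    have hsum := HasFDerivAt.fun_sum (u := Finset.univ) fun i _ =>
      HasFDerivAt.fun_sum (u := Finset.univ) fun k _ => hterm i k
    simpa only [dotProduct, Matrix.mulVec, Finset.mul_sum, Finset.sum_const_zero] using hsum
  have hmain := ((hG.const_mul 2).fun_sub hQ).fun_add hrem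
  rw [add_zero] at hmain
  exact hmain.congr_of_eventuallyEq
    (hu.mono fun y hy => Matrix.dotProduct_inv_mulVec_eq (hsymm y) hy (g y) w)

/-- Gradient of the distributional MSPBE, GTD2/TDC setup. -/
theorem dmspbe_gradient_tdc
    (d m : ℕ) (S : Type*) [Fintype S] [Nonempty S]
    (ρ : S → ℝ) (hρ0 : ∀ s, 0 ≤ ρ s) (hρ1 : ∑ s, ρ s = 1)
    (P : S → S → ℝ) (hP0 : ∀ s s', 0 ≤ P s s') (hP1 : ∀ s, ∑ s', P s s' = 1)
    (R : S → ℝ) (γ : ℝ) (hγ0 : 0 < γ) (hγ1 : γ < 1)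
    (z : Fin m → ℝ)
    (F : (Fin d → ℝ) → S → ℝ → ℝ)
    (hF : ∀ s x, ContDiff ℝ 2 (fun θ => F θ s x))
    (φ : (Fin d → ℝ) → S → ℝ → (Fin d → ℝ))
    (hφ : ∀ θ s x i, φ θ s x i = fderiv ℝ (fun θ' => F θ' s x) θ (Pi.single i 1))
    (δ : (Fin d → ℝ) → S → S → Fin m → ℝ)
    (hδ : ∀ θ s s' j, δ θ s s' j = F θ s' ((z j - R s) / γ) - F θ s (z j))
    (A : (Fin d → ℝ) → Matrix (Fin d) (Fin d) ℝ)
    (hA : ∀ θ, A θ = ∑ s, ∑ j, ρ s • vecMulVec (φ θ s (z j)) (φ θ s (z j)))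
    (g : (Fin d → ℝ) → (Fin d → ℝ))
    (hg : ∀ θ, g θ = ∑ s, ∑ s', ∑ j, (ρ s * P s s' * δ θ s s' j) • φ θ s (z j))
    (J : (Fin d → ℝ) → ℝ)
    (hJ : ∀ θ, J θ = g θ ⬝ᵥ (A θ)⁻¹.mulVec (g θ))
    (θ₀ : Fin d → ℝ)
    (hAinv : ∀ᶠ θ in nhds θ₀, IsUnit (A θ))
    (w : Fin d → ℝ) (hw : w = (A θ₀)⁻¹.mulVec (g θ₀))
    (Hess : S → Fin m → Matrix (Fin d) (Fin d) ℝ)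
    (hHess : ∀ s j i k, Hess s j i k =
      fderiv ℝ (fun θ => fderiv ℝ (fun θ' => F θ' s (z j)) θ (Pi.single k 1)) θ₀
        (Pi.single i 1))
    (h : Fin d → ℝ)
    (hh : h = ∑ s, ∑ s', ∑ j,
      (ρ s * P s s' * (δ θ₀ s s' j - w ⬝ᵥ φ θ₀ s (z j))) • (Hess s j).mulVec w) :
    ∀ v : Fin d → ℝ,
      -(1 / 2) * fderiv ℝ J θ₀ v =
        ((-(∑ s, ∑ s', ∑ j,
              (ρ s * P s s' * (φ θ₀ s (z j) ⬝ᵥ w)) • φ θ₀ s' ((z j - R s) / γ)))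
          + (∑ s, ∑ s', ∑ j, (ρ s * P s s' * δ θ₀ s s' j) • φ θ₀ s (z j))
          - h) ⬝ᵥ v := by
  intro v
  have hFφ : ∀ θ s x u, fderiv ℝ (fun θ' => F θ' s x) θ u = φ θ s x ⬝ᵥ u := fun θ s x u => by
    conv_lhs => rw [pi_eq_sum_univ' u, map_sum]
    simp [dotProduct, hφ, mul_comm]
  have hφdiff : ∀ s x i, DifferentiableAt ℝ (fun θ => φ θ s x i) θ₀ := fun s x i => by
    simp only [hφ]
    exact (((hF s x).fderiv_right (m := 1) (by norm_num)).differentiable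
      (by norm_num) θ₀).clm_apply (differentiableAt_const _)
  have hFdiff : ∀ s x, DifferentiableAt ℝ (fun θ => F θ s x) θ₀ := fun s x =>
    (hF s x).differentiable (by norm_num) θ₀
  have hδdiff : ∀ s s' j, DifferentiableAt ℝ (fun θ => δ θ s s' j) θ₀ := fun s s' j => by
    simp only [hδ]
    exact (hFdiff _ _).fun_sub (hFdiff _ _)
  have hδv : ∀ s s' j, fderiv ℝ (fun θ => δ θ s s' j) θ₀ v =
      φ θ₀ s' ((z j - R s) / γ) ⬝ᵥ v - φ θ₀ s (z j) ⬝ᵥ v := fun s s' j => by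
    simp only [hδ]
    rw [fderiv_fun_sub (hFdiff _ _) (hFdiff _ _), _root_.sub_apply, hFφ, hFφ]
  have hpdiff : ∀ s j, DifferentiableAt ℝ (fun θ => φ θ s (z j) ⬝ᵥ w) θ₀ := fun s j =>
    DifferentiableAt.fun_sum fun i _ => (hφdiff s (z j) i).mul_const _
  have hpv : ∀ s j, fderiv ℝ (fun θ => φ θ s (z j) ⬝ᵥ w) θ₀ v = (Hess s j *ᵥ w) ⬝ᵥ v :=
    fun s j => by
    have hk : ∀ k, fderiv ℝ (fun θ => φ θ s (z j) k) θ₀ v = ∑ i, Hess s j i k * v i :=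
      fun k => by
      conv_lhs => rw [pi_eq_sum_univ' v, map_sum]
      simp [hHess, hφ, mul_comm]
    simp only [dotProduct, Matrix.mulVec]
    rw [fderiv_fun_sum fun i _ => (hφdiff s (z j) i).mul_const _, _root_.sum_apply]
    simp only [fderiv_mul_const (hφdiff s (z j) _), _root_.smul_apply, hk,
      smul_eq_mul, Finset.mul_sum, Finset.sum_mul]
    rw [Finset.sum_comm]
    exact Finset.sum_congr rfl fun i _ => Finset.sum_congr rfl fun k _ => by ring
  have hAw : ∀ θ u, A θ *ᵥ u = ∑ s, ∑ j, (ρ s * (φ θ s (z j) ⬝ᵥ u)) • φ θ s (z j) :=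
    fun θ u => by
    simp only [hA, Matrix.sum_mulVec, Matrix.smul_mulVec, Matrix.vecMulVec_mulVec]
    simp [smul_smul]
  have hG := HasFDerivAt.fun_sum (u := Finset.univ) fun s _ =>
    HasFDerivAt.fun_sum (u := Finset.univ) fun s' _ =>
    HasFDerivAt.fun_sum (u := Finset.univ) fun j _ =>
      (((hδdiff s s' j).hasFDerivAt.fun_mul (hpdiff s j).hasFDerivAt).const_mul (ρ s * P s s'))
  have hQ := HasFDerivAt.fun_sum (u := Finset.univ) fun s _ =>
    HasFDerivAt.fun_sum (u := Finset.univ) fun j _ =>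
      (((hpdiff s j).hasFDerivAt.fun_mul (hpdiff s j).hasFDerivAt).const_mul (ρ s))
  have hJ' := Matrix.hasFDerivAt_dotProduct_inv_mulVec (A := A) (g := g) (x := θ₀)
    (fun θ => by
      rw [hA]
      ext i k
      simp [Matrix.sum_apply, Matrix.vecMulVec_apply, mul_comm])
    (fun i k => by
      simp only [hA, Matrix.sum_apply, Matrix.smul_apply, Matrix.vecMulVec_apply, smul_eq_mul]
      exact DifferentiableAt.fun_sum fun s _ => DifferentiableAt.fun_sum fun j _ =>
        ((hφdiff _ _ _).fun_mul (hφdiff _ _ _)).const_mul _)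
    (fun i => by
      simp only [hg, Finset.sum_apply, Pi.smul_apply, smul_eq_mul]
      exact DifferentiableAt.fun_sum fun s _ => DifferentiableAt.fun_sum fun s' _ =>
        DifferentiableAt.fun_sum fun j _ => ((hδdiff _ _ _).const_mul _).fun_mul (hφdiff _ _ _))
    hAinv hw
    (hG.congr_of_eventuallyEq (.of_forall fun θ => by
      simp only [hg, sum_dotProduct, smul_dotProduct, smul_eq_mul, mul_assoc]))
    (hQ.congr_of_eventuallyEq (.of_forall fun θ => by
      simp only [hAw, dotProduct_comm w, sum_dotProduct, smul_dotProduct, smul_eq_mul,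
        mul_assoc]))
  have hgv : (∑ s, ∑ s', ∑ j, (ρ s * P s s' * δ θ₀ s s' j) • φ θ₀ s (z j)) =
      ∑ s, ∑ j, (ρ s * (φ θ₀ s (z j) ⬝ᵥ w)) • φ θ₀ s (z j) := by
    rw [← hg, ← hAw, hw, Matrix.mulVec_mulVec, Matrix.mul_nonsing_inv _
      ((Matrix.isUnit_iff_isUnit_det _).1 hAinv.self_of_nhds), Matrix.one_mulVec]
  have hP : ∀ f : S → Fin m → ℝ,
      ∑ s, ∑ j, ρ s * f s j = ∑ s, ∑ s', ∑ j, ρ s * P s s' * f s j := fun f =>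
    Finset.sum_congr rfl fun s _ => by
      simp only [← Finset.mul_sum, mul_assoc]
      rw [← Finset.sum_mul, hP1, one_mul]
  rw [hgv, funext hJ, hJ'.fderiv, hh]
  simp only [_root_.sub_apply, _root_.add_apply,
    _root_.smul_apply, _root_.sum_apply, hδv, hpv, smul_eq_mul,
    sub_dotProduct, add_dotProduct, neg_dotProduct, sum_dotProduct, smul_dotProduct,
    mul_assoc (ρ _) (_ ⬝ᵥ _), hP, dotProduct_comm w]
  simp only [Finset.mul_sum, ← Finset.sum_neg_distrib, ← Finset.sum_add_distrib,
    ← Finset.sum_sub_distrib]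
  exact Finset.sum_congr rfl fun s _ => Finset.sum_congr rfl fun s' _ =>
    Finset.sum_congr rfl fun j _ => by ring
end
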